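/- arXiv:1304.6102 — 6 statements merged into one kernel-verified Lean document; each statement's English description precedes it below -/
import Mathlib

section
/- Let a < b be real numbers, let ε > 0 and λ > 0. Let φ : [a,b] → ℝ be twice differentiable with φ' monotonic on [a,b] and |φ'(t)| ≥ ε for all t ∈ [a,b]. Let f : [a,b] → ℝ be differentiable with derivative f' Lebesgue integrable on [a,b]. Then |∫_a^b f(t) e^{iλφ(t)} dt| ≤ (3/(λε)) · ( min{|f(a)|, |f(b)|} + ∫_a^b |f'(t)| dt ). -/
open MeasureTheory Set

lemma vdc_ofReal {c d : ℝ} {u : ℝ → ℝ} (h : IntervalIntegrable u volume c d) :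
    IntervalIntegrable (fun t => (u t : ℂ)) volume c d := ⟨h.1.ofReal, h.2.ofReal⟩

lemma vdc_abs_deriv (c d : ℝ) (hcd : c ≤ d) (u u' : ℝ → ℝ) (hu : ContinuousOn u (Icc c d))
    (hd : ∀ t ∈ Ioo c d, HasDerivAt u (u' t) t) (hpos : ∀ t ∈ Ioo c d, 0 ≤ u' t) :
    IntervalIntegrable u' volume c d ∧ ∫ t in c..d, |u' t| = |u d - u c| := by
  have hi : IntervalIntegrable u' volume c d := by
    apply intervalIntegral.intervalIntegrable_deriv_of_nonneg (g := u)
    · rwa [uIcc_of_le hcd]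
    · simpa [hcd] using hd
    · simpa [hcd] using hpos
  refine ⟨hi, ?_⟩
  have h1 := intervalIntegral.integral_eq_sub_of_hasDerivAt_of_le hcd hu hd hi
  have h2 : ∫ t in c..d, |u' t| = ∫ t in c..d, u' t := by
    apply intervalIntegral.integral_congr_ae
    have : ∀ᵐ t : ℝ ∂volume, t ≠ d := by
      simp [ae_iff]
    filter_upwards [this] with t ht hm
    rw [uIoc_of_le hcd] at hm
    exact abs_of_nonneg (hpos t ⟨hm.1, lt_of_le_of_ne hm.2 ht⟩)
  have h3 : 0 ≤ ∫ t in c..d, |u' t| :=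
    intervalIntegral.integral_nonneg hcd (fun t _ => abs_nonneg _)
  rw [abs_of_nonneg (by linarith), h2, h1]

lemma vdc_basic (c d ε lam : ℝ) (hcd : c ≤ d) (hε : 0 < ε) (hlam : 0 < lam)
    (φ φ' φ'' : ℝ → ℝ)
    (hφc : ContinuousOn φ (Icc c d)) (hφ'c : ContinuousOn φ' (Icc c d))
    (hφ : ∀ t ∈ Ioo c d, HasDerivAt φ (φ' t) t)
    (hφ' : ∀ t ∈ Ioo c d, HasDerivAt φ' (φ'' t) t)
    (hs : (∀ t ∈ Ioo c d, 0 ≤ φ'' t) ∨ (∀ t ∈ Ioo c d, φ'' t ≤ 0))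
    (hφε : ∀ t ∈ Icc c d, ε ≤ |φ' t|) :
    ‖∫ t in c..d, Complex.exp (Complex.I * (lam : ℂ) * (φ t : ℂ))‖ ≤ 3 / (lam * ε) := by
  have hne : ∀ t ∈ Icc c d, φ' t ≠ 0 := fun t ht h => by
    have := hφε t ht
    rw [h, abs_zero] at this; linarith
  set E : ℝ → ℂ := fun t => Complex.exp (Complex.I * (lam : ℂ) * (φ t : ℂ)) with hE
  have hEn : ∀ t, ‖E t‖ = 1 := fun t => by
    have : Complex.I * (lam : ℂ) * (φ t : ℂ) = ((lam * φ t : ℝ) : ℂ) * Complex.I := by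
      push_cast; ring
    simp only [hE]
    rw [this, Complex.norm_exp_ofReal_mul_I]
  have hEc : ContinuousOn E (Icc c d) := by
    simp only [hE]; fun_prop
  set g : ℝ → ℝ := fun t => (lam * φ' t)⁻¹ with hg
  set g' : ℝ → ℝ := fun t => -(lam * φ'' t) / (lam * φ' t) ^ 2 with hg'
  have hgc : ContinuousOn g (Icc c d) :=
    ContinuousOn.inv₀ (by fun_prop) (fun t ht => mul_ne_zero hlam.ne' (hne t ht))
  have hgd : ∀ t ∈ Ioo c d, HasDerivAt g (g' t) t := fun t ht =>
    ((hφ' t ht).const_mul lam).inv (mul_ne_zero hlam.ne' (hne t (Ioo_subset_Icc_self ht)))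
  have hgK : ∀ t ∈ Icc c d, |g t| ≤ 1 / (lam * ε) := fun t ht => by
    simp only [hg]
    rw [abs_inv, abs_mul, abs_of_pos hlam, ← one_div]
    have := hφε t ht
    gcongr
  have key : IntervalIntegrable g' volume c d ∧ ∫ t in c..d, |g' t| = |g d - g c| := by
    rcases hs with hs | hs
    · have := vdc_abs_deriv c d hcd (fun t => - g t) (fun t => - g' t) hgc.neg
        (fun t ht => (hgd t ht).neg) (fun t ht => by
          have := hs t ht
          simp only [hg', neg_div, neg_neg]; positivity)
      refine ⟨by
        have h := this.1.neg
        have e : (-fun t => -g' t) = g' := by ext t; simp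
        rwa [e] at h, ?_⟩
      have h2 := this.2
      simp only [abs_neg] at h2
      rw [h2, ← abs_neg]; congr 1; ring
    · exact vdc_abs_deriv c d hcd g g' hgc hgd (fun t ht => by
          have := hs t ht
          have h0 : 0 ≤ -(lam * φ'' t) := by nlinarith
          simp only [hg']; positivity)
  have hsame : |g d - g c| ≤ 1 / (lam * ε) := by
    have hc := hgK c ⟨le_rfl, hcd⟩
    have hd := hgK d ⟨hcd, le_rfl⟩
    have hz : (0:ℝ) ∉ uIcc (g c) (g d) := fun h => by
      have := intermediate_value_uIcc (by rwa [uIcc_of_le hcd]) h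
      rw [uIcc_of_le hcd] at this
      obtain ⟨t, ht, h0⟩ := this
      exact inv_ne_zero (mul_ne_zero hlam.ne' (hne t ht)) h0
    rw [mem_uIcc] at hz
    push Not at hz
    rw [abs_le] at *
    rcases le_or_gt (g c) 0 with h | h
    · have := hz.1 h
      constructor <;> linarith
    · have : 0 < g d := by
        by_contra hh
        exact absurd (hz.2 (not_lt.1 hh)) (not_lt.2 h.le)
      constructor <;> linarith
  have hEi : IntervalIntegrable E volume c d :=
    ContinuousOn.intervalIntegrable (by rwa [uIcc_of_le hcd])
  have hgEi : IntervalIntegrable (fun t => (g' t : ℂ) * E t) volume c d :=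
    IntervalIntegrable.mul_continuousOn (vdc_ofReal key.1)
      (by rwa [uIcc_of_le hcd])
  have hH := intervalIntegral.integral_eq_sub_of_hasDerivAt_of_le hcd
    (f := fun t => (g t : ℂ) * E t) (f' := fun t => (g' t : ℂ) * E t + Complex.I * E t)
    (by fun_prop)
    (fun t ht => by
      have h1 := (hgd t ht).ofReal_comp
      have h2 := (((hφ t ht).ofReal_comp).const_mul (Complex.I * (lam : ℂ))).cexp
      refine (h1.mul h2).congr_deriv ?_
      have h3 : (φ' t : ℂ) ≠ 0 := by exact_mod_cast hne t (Ioo_subset_Icc_self ht)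
      have h4 : (lam : ℂ) ≠ 0 := by exact_mod_cast hlam.ne'
      simp only [hg, hE]
      push_cast
      field_simp)
    (hgEi.add (hEi.const_mul _))
  rw [intervalIntegral.integral_add hgEi (hEi.const_mul _),
    intervalIntegral.integral_const_mul] at hH
  have h5 : Complex.I * ∫ t in c..d, E t =
      (g d : ℂ) * E d - (g c : ℂ) * E c - ∫ t in c..d, (g' t : ℂ) * E t := by
    rw [← hH]; ring
  have h6 : ‖∫ t in c..d, E t‖ = ‖Complex.I * ∫ t in c..d, E t‖ := by simp
  have h7 : ‖∫ t in c..d, (g' t : ℂ) * E t‖ ≤ |g d - g c| := by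
    rw [← key.2]
    refine (intervalIntegral.norm_integral_le_integral_norm hcd).trans (le_of_eq ?_)
    simp [hEn]
  rw [h6, h5]
  have hc := hgK c ⟨le_rfl, hcd⟩
  have hd := hgK d ⟨hcd, le_rfl⟩
  have e1 : ‖(g d : ℂ) * E d‖ = |g d| := by simp [hEn]
  have e2 : ‖(g c : ℂ) * E c‖ = |g c| := by simp [hEn]
  have n1 := norm_sub_le ((g d : ℂ) * E d - (g c : ℂ) * E c) (∫ t in c..d, (g' t : ℂ) * E t)
  have n2 := norm_sub_le ((g d : ℂ) * E d) ((g c : ℂ) * E c)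
  have : 3 / (lam * ε) = 1 / (lam * ε) + 1 / (lam * ε) + 1 / (lam * ε) := by ring
  linarith

lemma vdc_parts (a b K : ℝ) (hab : a ≤ b) (f f' : ℝ → ℝ) (E F : ℝ → ℂ)
    (hfc : ContinuousOn f (Icc a b)) (hf : ∀ t ∈ Ioo a b, HasDerivAt f (f' t) t)
    (hf'int : IntervalIntegrable f' volume a b)
    (hE : ContinuousOn E (Icc a b)) (hFc : ContinuousOn F (Icc a b))
    (hF : ∀ t ∈ Ioo a b, HasDerivAt F (E t) t)
    (hK : ∀ t ∈ Icc a b, ‖F t‖ ≤ K) :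
    ‖∫ t in a..b, (f t : ℂ) * E t‖ ≤
      ‖(f b : ℂ) * F b - f a * F a‖ + K * ∫ t in a..b, |f' t| := by
  have i1 : IntervalIntegrable (fun t => (f' t : ℂ) * F t) volume a b :=
    IntervalIntegrable.mul_continuousOn (vdc_ofReal hf'int)
      (by rwa [uIcc_of_le hab])
  have i2 : IntervalIntegrable (fun t => (f t : ℂ) * E t) volume a b :=
    ContinuousOn.intervalIntegrable (by rw [uIcc_of_le hab]; fun_prop)
  have hH := intervalIntegral.integral_eq_sub_of_hasDerivAt_of_le hab
    (f := fun t => (f t : ℂ) * F t) (f' := fun t => (f' t : ℂ) * F t + f t * E t)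
    (by fun_prop) (fun t ht => ((hf t ht).ofReal_comp).mul (hF t ht)) (i1.add i2)
  rw [intervalIntegral.integral_add i1 i2] at hH
  have h5 : ∫ t in a..b, (f t : ℂ) * E t = ((f b : ℂ) * F b - f a * F a)
      - ∫ t in a..b, (f' t : ℂ) * F t := by rw [← hH]; ring
  have h7 : ‖∫ t in a..b, (f' t : ℂ) * F t‖ ≤ K * ∫ t in a..b, |f' t| := by
    rw [← intervalIntegral.integral_const_mul]
    refine (intervalIntegral.norm_integral_le_integral_norm hab).trans ?_
    refine intervalIntegral.integral_mono_on hab i1.norm (hf'int.abs.const_mul _) ?_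
    intro t ht
    have := hK t ht
    rw [norm_mul, Complex.norm_real, Real.norm_eq_abs, mul_comm]
    gcongr
  rw [h5]
  exact (norm_sub_le _ _).trans (by linarith)


/-- Van der Corput lemma with amplitude, case `d = 1`: if `φ` is twice differentiable on
`[a,b]` with monotone derivative `φ'` satisfying `|φ'| ≥ ε`, and `f` is differentiable with
integrable derivative, then `|∫_a^b f(t) e^{iλφ(t)} dt| ≤ (3/(λε)) (min(|f a|,|f b|) + ∫|f'|)`. -/
theorem vanDerCorput_amplitude_first_order
    (a b ε lam : ℝ) (hab : a < b) (hε : 0 < ε) (hlam : 0 < lam)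
    (φ φ' φ'' f f' : ℝ → ℝ)
    (hφ : ∀ t ∈ Set.Icc a b, HasDerivWithinAt φ (φ' t) (Set.Icc a b) t)
    (hφ' : ∀ t ∈ Set.Icc a b, HasDerivWithinAt φ' (φ'' t) (Set.Icc a b) t)
    (hmono : MonotoneOn φ' (Set.Icc a b) ∨ AntitoneOn φ' (Set.Icc a b))
    (hφε : ∀ t ∈ Set.Icc a b, ε ≤ |φ' t|)
    (hf : ∀ t ∈ Set.Icc a b, HasDerivWithinAt f (f' t) (Set.Icc a b) t)
    (hf'int : IntervalIntegrable f' volume a b) :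
    ‖∫ t in a..b, (f t : ℂ) * Complex.exp (Complex.I * (lam : ℂ) * (φ t : ℂ))‖ ≤
      (3 / (lam * ε)) * (min |f a| |f b| + ∫ t in a..b, |f' t|) := by
  have nhd : ∀ t ∈ Ioo a b, Icc a b ∈ nhds t := fun t ht => Icc_mem_nhds ht.1 ht.2
  have hφc : ContinuousOn φ (Icc a b) := fun t ht => (hφ t ht).continuousWithinAt
  have hφ'c : ContinuousOn φ' (Icc a b) := fun t ht => (hφ' t ht).continuousWithinAt
  have hfc : ContinuousOn f (Icc a b) := fun t ht => (hf t ht).continuousWithinAt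
  have dφ : ∀ t ∈ Ioo a b, HasDerivAt φ (φ' t) t :=
    fun t ht => (hφ t (Ioo_subset_Icc_self ht)).hasDerivAt (nhd t ht)
  have dφ' : ∀ t ∈ Ioo a b, HasDerivAt φ' (φ'' t) t :=
    fun t ht => (hφ' t (Ioo_subset_Icc_self ht)).hasDerivAt (nhd t ht)
  have df : ∀ t ∈ Ioo a b, HasDerivAt f (f' t) t :=
    fun t ht => (hf t (Ioo_subset_Icc_self ht)).hasDerivAt (nhd t ht)
  have hs : (∀ t ∈ Ioo a b, 0 ≤ φ'' t) ∨ (∀ t ∈ Ioo a b, φ'' t ≤ 0) := by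
    have ud : ∀ t ∈ Ioo a b, derivWithin φ' (Icc a b) t = φ'' t := fun t ht =>
      (hφ' t (Ioo_subset_Icc_self ht)).derivWithin
        (uniqueDiffOn_Icc hab t (Ioo_subset_Icc_self ht))
    rcases hmono with h | h
    · left; intro t ht; rw [← ud t ht]; exact h.derivWithin_nonneg
    · right; intro t ht; rw [← ud t ht]; exact h.derivWithin_nonpos
  have base : ∀ c d, a ≤ c → c ≤ d → d ≤ b →
      ‖∫ t in c..d, Complex.exp (Complex.I * (lam : ℂ) * (φ t : ℂ))‖ ≤ 3 / (lam * ε) := by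
    intro c d hac hcd hdb
    have s1 : Icc c d ⊆ Icc a b := Icc_subset_Icc hac hdb
    have s2 : Ioo c d ⊆ Ioo a b := Ioo_subset_Ioo hac hdb
    exact vdc_basic c d ε lam hcd hε hlam φ φ' φ'' (hφc.mono s1) (hφ'c.mono s1)
      (fun t ht => dφ t (s2 ht)) (fun t ht => dφ' t (s2 ht))
      (hs.imp (fun h t ht => h t (s2 ht)) (fun h t ht => h t (s2 ht)))
      (fun t ht => hφε t (s1 ht))
  set E : ℝ → ℂ := fun t => Complex.exp (Complex.I * (lam : ℂ) * (φ t : ℂ)) with hE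
  have hEc : ContinuousOn E (Icc a b) := by
    simp only [hE]; fun_prop
  have hEi : IntervalIntegrable E volume a b :=
    ContinuousOn.intervalIntegrable (by rwa [uIcc_of_le hab.le])
  set F : ℝ → ℂ := fun x => ∫ t in a..x, E t with hFdef
  have hFc : ContinuousOn F (Icc a b) := by
    have := intervalIntegral.continuousOn_primitive_interval (μ := volume) (f := E)
      (a := a) (b := b) (by rw [uIcc_of_le hab.le]; exact hEc.integrableOn_Icc)
    rwa [uIcc_of_le hab.le] at this
  have hEi2 : ∀ c ∈ Icc a b, ∀ d ∈ Icc a b, IntervalIntegrable E volume c d := by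
    intro c hc d hd
    exact ContinuousOn.intervalIntegrable (hEc.mono (by
      rw [← uIcc_of_le hab.le]; apply uIcc_subset_uIcc <;> rwa [uIcc_of_le hab.le]))
  have dF : ∀ t ∈ Ioo a b, HasDerivAt F (E t) t := by
    intro t ht
    refine intervalIntegral.integral_hasDerivAt_right
      (hEi2 a ⟨le_rfl, hab.le⟩ t (Ioo_subset_Icc_self ht)) ?_ (hEc.continuousAt (nhd t ht))
    exact (hEc.mono Ioo_subset_Icc_self).stronglyMeasurableAtFilter isOpen_Ioo t ht
  have hG : ∀ t ∈ Icc a b, F t - F b = - ∫ s in t..b, E s := by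
    intro t ht
    have := intervalIntegral.integral_add_adjacent_intervals
      (hEi2 a ⟨le_rfl, hab.le⟩ t ht) (hEi2 t ht b ⟨hab.le, le_rfl⟩)
    simp only [hFdef]
    rw [← this]; ring
  have P1 := vdc_parts a b (3 / (lam * ε)) hab.le f f' E F hfc df hf'int hEc hFc dF
    (fun t ht => base a t le_rfl ht.1 ht.2)
  have P2 := vdc_parts a b (3 / (lam * ε)) hab.le f f' E (fun t => F t - F b) hfc df hf'int hEc
    (by fun_prop) (fun t ht => (dF t ht).sub_const _)
    (fun t ht => by
      simp only [hG t ht, norm_neg]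
      exact base t b ht.1 ht.2 le_rfl)
  have hFa : F a = 0 := by simp [hFdef]
  have hFb : ‖F b‖ ≤ 3 / (lam * ε) := base a b le_rfl hab.le le_rfl
  rw [hFa] at P1 P2
  simp only [mul_zero, sub_zero, sub_self, zero_sub, norm_mul, mul_neg, neg_neg,
    Complex.norm_real, Real.norm_eq_abs] at P1 P2
  rw [mul_add]
  have q1 := mul_le_mul_of_nonneg_left hFb (abs_nonneg (f a))
  have q2 := mul_le_mul_of_nonneg_left hFb (abs_nonneg (f b))
  rcases min_choice |f a| |f b| with h | h <;> rw [h] <;> linarith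
end

section
/- Let a < b be real numbers, let d ≥ 2 be an integer, let ε > 0 and λ > 0. Let φ : [a,b] → ℝ be d-times differentiable with |φ^{(d)}(t)| ≥ ε for all t ∈ [a,b]. Let f : [a,b] → ℝ be differentiable with derivative f' Lebesgue integrable on [a,b]. Then |∫_a^b f(t) e^{iλφ(t)} dt| ≤ (c_d/(λε)^{1/d}) · ( min{|f(a)|, |f(b)|} + ∫_a^b |f'(t)| dt ), where c_d = 5·2^{d−1} − 2. -/
open MeasureTheory Set

/-- The exponential of a phase with continuous phase function is continuous. -/
theorem vdc_cont {a b : ℝ} {p : ℝ → ℝ} (hp : ContinuousOn p (Icc a b)) :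
    ContinuousOn (fun t => Complex.exp (Complex.I * (p t : ℂ))) (Icc a b) := by
  have h1 : ContinuousOn (fun t => (p t : ℂ)) (Icc a b) :=
    Complex.continuous_ofReal.comp_continuousOn hp
  exact Complex.continuous_exp.comp_continuousOn (continuousOn_const.mul h1)

theorem vdc_norm (x : ℝ) : ‖Complex.exp (Complex.I * (x : ℂ))‖ = 1 := by
  rw [mul_comm]; exact Complex.norm_exp_ofReal_mul_I x

/-- First derivative test with monotone derivative. -/
theorem vdc_base {a b m : ℝ} (hab : a ≤ b) (hm : 0 < m) {p p1 p2 : ℝ → ℝ}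
    (h0 : ∀ t ∈ Icc a b, HasDerivWithinAt p (p1 t) (Icc a b) t)
    (h1 : ∀ t ∈ Icc a b, HasDerivWithinAt p1 (p2 t) (Icc a b) t)
    (h2 : ∀ t ∈ Icc a b, 0 ≤ p2 t) (hlow : ∀ t ∈ Icc a b, m ≤ |p1 t|) :
    ‖∫ t in a..b, Complex.exp (Complex.I * (p t : ℂ))‖ ≤ 3 / m := by
  have hne : ∀ t ∈ Icc a b, p1 t ≠ 0 := fun t ht h => by
    have := hlow t ht; rw [h, abs_zero] at this; linarith
  have hc0 : ContinuousOn p (Icc a b) := fun t ht => (h0 t ht).continuousWithinAt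
  have hc1 : ContinuousOn p1 (Icc a b) := fun t ht => (h1 t ht).continuousWithinAt
  set w : ℝ → ℝ := fun t => -(p1 t)⁻¹ with hw
  set w' : ℝ → ℝ := fun t => p2 t / (p1 t) ^ 2 with hw'
  have hwd : ∀ t ∈ Icc a b, HasDerivWithinAt w (w' t) (Icc a b) t := fun t ht => by
    have := ((h1 t ht).inv (hne t ht)).neg
    have e : w' t = -(-p2 t / p1 t ^ 2) := by simp only [hw']; ring
    rw [e]
    exact this
  have hwc : ContinuousOn w (Icc a b) := fun t ht => (hwd t ht).continuousWithinAt
  have hw'0 : ∀ t ∈ Icc a b, 0 ≤ w' t := fun t ht => div_nonneg (h2 t ht) (sq_nonneg _)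
  have hwi : IntervalIntegrable w' volume a b := by
    apply intervalIntegral.intervalIntegrable_deriv_of_nonneg (g := w)
    · rwa [uIcc_of_le hab]
    · intro x hx
      rw [min_eq_left hab, max_eq_right hab] at hx
      exact (hwd x (Ioo_subset_Icc_self hx)).hasDerivAt (Icc_mem_nhds hx.1 hx.2)
    · intro x hx
      rw [min_eq_left hab, max_eq_right hab] at hx
      exact hw'0 x (Ioo_subset_Icc_self hx)
  have hwint : ∫ t in a..b, w' t = w b - w a :=
    intervalIntegral.integral_eq_sub_of_hasDerivAt_of_le hab hwc
      (fun x hx => (hwd x (Ioo_subset_Icc_self hx)).hasDerivAt (Icc_mem_nhds hx.1 hx.2)) hwi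
  set v : ℝ → ℂ := fun t => Complex.exp (Complex.I * (p t : ℂ)) with hv
  set v' : ℝ → ℂ := fun t => Complex.exp (Complex.I * (p t : ℂ)) * (Complex.I * (p1 t : ℂ)) with hv'
  have hvd : ∀ t ∈ Icc a b, HasDerivWithinAt v (v' t) (Icc a b) t := fun t ht =>
    (((h0 t ht).ofReal_comp).const_mul Complex.I).cexp
  have hvi : IntervalIntegrable v' volume a b := by
    apply ContinuousOn.intervalIntegrable
    rw [uIcc_of_le hab]
    exact (vdc_cont hc0).mul
      (continuousOn_const.mul (Complex.continuous_ofReal.comp_continuousOn hc1))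
  have key := intervalIntegral.integral_mul_deriv_eq_deriv_mul_of_hasDerivWithinAt
    (u := fun t => (w t : ℂ)) (u' := fun t => (w' t : ℂ)) (v := v) (v' := v') (a := a) (b := b)
    (by rw [uIcc_of_le hab]; exact fun x hx => (hwd x hx).ofReal_comp)
    (by rw [uIcc_of_le hab]; exact hvd) ⟨hwi.1.ofReal, hwi.2.ofReal⟩ hvi
  have hL : ∫ t in a..b, (w t : ℂ) * v' t = -Complex.I * ∫ t in a..b, v t := by
    rw [← intervalIntegral.integral_const_mul]
    apply intervalIntegral.integral_congr
    intro t ht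
    rw [uIcc_of_le hab] at ht
    have : (p1 t : ℂ) ≠ 0 := by exact_mod_cast hne t ht
    simp only [hw, hv', hv]
    push_cast
    field_simp
  have hR : ‖∫ t in a..b, (w' t : ℂ) * v t‖ ≤ w b - w a := by
    rw [← hwint]
    apply intervalIntegral.norm_integral_le_of_norm_le hab _ hwi
    refine Filter.Eventually.of_forall fun t ht => ?_
    have ht' := Ioc_subset_Icc_self ht
    rw [norm_mul, hv, vdc_norm, mul_one, Complex.norm_real, Real.norm_of_nonneg (hw'0 t ht')]
  have ha : a ∈ Icc a b := ⟨le_rfl, hab⟩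
  have hb : b ∈ Icc a b := ⟨hab, le_rfl⟩
  have hwb : ∀ t ∈ Icc a b, |w t| ≤ 1 / m := fun t ht => by
    simp only [hw, abs_neg, abs_inv]
    rw [one_div]
    exact inv_anti₀ hm (hlow t ht)
  have hdiff : w b - w a ≤ 1 / m := by
    have e1 := abs_le.1 (hwb a ha)
    have e2 := abs_le.1 (hwb b hb)
    rcases hasDerivWithinAt_forall_lt_or_forall_gt_of_forall_ne (convex_Icc a b) h0 hne with h | h
    · have : 0 ≤ w a := by
        simp only [hw]; have := inv_lt_zero.2 (h a ha); linarith
      linarith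
    · have : w b ≤ 0 := by
        simp only [hw]; have := inv_pos.2 (h b hb); linarith
      linarith
  have hn : ‖∫ t in a..b, v t‖ = ‖∫ t in a..b, (w t : ℂ) * v' t‖ := by
    rw [hL, norm_mul, norm_neg, Complex.norm_I, one_mul]
  have e1 : ‖(w b : ℂ) * v b‖ ≤ 1 / m := by
    rw [norm_mul, hv, vdc_norm, mul_one, Complex.norm_real]; exact hwb b hb
  have e2 : ‖(w a : ℂ) * v a‖ ≤ 1 / m := by
    rw [norm_mul, hv, vdc_norm, mul_one, Complex.norm_real]; exact hwb a ha
  rw [hn, key]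
  have e3 := norm_sub_le ((w b : ℂ) * v b - (w a : ℂ) * v a) (∫ t in a..b, (w' t : ℂ) * v t)
  have e4 := norm_sub_le ((w b : ℂ) * v b) ((w a : ℂ) * v a)
  have e5 : (3 : ℝ) / m = 1 / m + 1 / m + 1 / m := by ring
  linarith

/-- Bound for a monotone (or first-order) chain. -/
def VdcR (n : ℕ) : Prop :=
  ∀ (a b m : ℝ) (P : ℕ → ℝ → ℝ), a ≤ b → 0 < m →
    (∀ k < n + 2, ∀ t ∈ Icc a b, HasDerivWithinAt (P k) (P (k + 1) t) (Icc a b) t) →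
    (∀ t ∈ Icc a b, 0 ≤ P (n + 2) t) → (∀ t ∈ Icc a b, m ≤ |P (n + 1) t|) →
    ‖∫ t in a..b, Complex.exp (Complex.I * (P 0 t : ℂ))‖ ≤
      (5 * 2 ^ n - 2) / m ^ ((1 : ℝ) / (n + 1 : ℕ))

/-- A nearest zero. -/
theorem vdc_zero {a b m : ℝ} (hab : a ≤ b) (hm : 0 < m) {g g' : ℝ → ℝ}
    (hg : ∀ t ∈ Icc a b, HasDerivWithinAt g (g' t) (Icc a b) t)
    (hg' : ∀ t ∈ Icc a b, m ≤ g' t) :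
    ∃ z ∈ Icc a b, ∀ t ∈ Icc a b, m * |t - z| ≤ |g t| := by
  have hc : ContinuousOn g (Icc a b) := fun t ht => (hg t ht).continuousWithinAt
  have hd : ∀ x ∈ interior (Icc a b), HasDerivAt g (g' x) x := fun x hx => by
    rw [interior_Icc] at hx
    exact (hg x (Ioo_subset_Icc_self hx)).hasDerivAt (Icc_mem_nhds hx.1 hx.2)
  have hinc := (convex_Icc a b).mul_sub_le_image_sub_of_le_deriv hc
    (fun x hx => (hd x hx).differentiableAt.differentiableWithinAt) (C := m)
    (fun x hx => by rw [(hd x hx).deriv]; exact hg' x (interior_subset hx))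
  have ha : a ∈ Icc a b := ⟨le_rfl, hab⟩
  have hb : b ∈ Icc a b := ⟨hab, le_rfl⟩
  by_cases h1 : 0 ≤ g a
  · refine ⟨a, ha, fun t ht => ?_⟩
    have := hinc a ha t ht ht.1
    rw [abs_of_nonneg (by linarith [ht.1] : 0 ≤ t - a)]
    exact le_trans (by linarith) (le_abs_self _)
  by_cases h2 : g b ≤ 0
  · refine ⟨b, hb, fun t ht => ?_⟩
    have := hinc t ht b hb ht.2
    rw [abs_of_nonpos (by linarith [ht.2] : t - b ≤ 0), neg_sub]
    exact le_trans (by linarith) (neg_le_abs _)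
  push Not at h1 h2
  obtain ⟨z, hz, hz0⟩ := intermediate_value_Icc hab hc ⟨h1.le, h2.le⟩
  refine ⟨z, hz, fun t ht => ?_⟩
  rcases le_total t z with h | h
  · have := hinc t ht z hz h
    rw [abs_of_nonpos (by linarith : t - z ≤ 0), neg_sub]
    exact le_trans (by linarith) (neg_le_abs _)
  · have := hinc z hz t ht h
    rw [abs_of_nonneg (by linarith : 0 ≤ t - z)]
    exact le_trans (by linarith) (le_abs_self _)

theorem vdc_step_pos {n : ℕ} (hR : VdcR n) (a b m : ℝ) (P : ℕ → ℝ → ℝ) (hab : a ≤ b) (hm : 0 < m)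
    (hP : ∀ k < n + 2, ∀ t ∈ Icc a b, HasDerivWithinAt (P k) (P (k + 1) t) (Icc a b) t)
    (hlow : ∀ t ∈ Icc a b, m ≤ P (n + 2) t) :
    ‖∫ t in a..b, Complex.exp (Complex.I * (P 0 t : ℂ))‖ ≤
      (5 * 2 ^ (n + 1) - 2) / m ^ ((1 : ℝ) / (n + 2 : ℕ)) := by
  obtain ⟨z, hz, hzl⟩ := vdc_zero hab hm (hP (n + 1) (by omega)) hlow
  set M : ℝ := m ^ ((1 : ℝ) / (n + 2 : ℕ)) with hM
  have hM0 : 0 < M := Real.rpow_pos_of_pos hm _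
  set δ : ℝ := 1 / M with hδ
  have hδ0 : 0 < δ := by positivity
  have hpow : (m * δ) ^ ((1 : ℝ) / (n + 1 : ℕ)) = M := by
    have e1 : m * δ = m ^ (1 - (1 : ℝ) / (n + 2 : ℕ)) := by
      rw [Real.rpow_sub hm, Real.rpow_one, hδ]; ring
    rw [e1, ← Real.rpow_mul hm.le, hM]
    congr 1
    push_cast
    have : (n : ℝ) + 1 ≠ 0 := by positivity
    have : (n : ℝ) + 2 ≠ 0 := by positivity
    field_simp
    ring
  have hcnn : (0 : ℝ) ≤ 5 * 2 ^ n - 2 := by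
    have : (1 : ℝ) ≤ 2 ^ n := one_le_pow₀ (by norm_num)
    linarith
  have hsub : ∀ x y, a ≤ x → y ≤ b → x ≤ y → (∀ t ∈ Icc x y, δ ≤ |t - z|) →
      ‖∫ t in x..y, Complex.exp (Complex.I * (P 0 t : ℂ))‖ ≤ (5 * 2 ^ n - 2) / M := by
    intro x y hx hy hxy hdist
    have hss : Icc x y ⊆ Icc a b := Icc_subset_Icc hx hy
    have := hR x y (m * δ) P hxy (by positivity)
      (fun k hk t ht => (hP k hk t (hss ht)).mono hss)
      (fun t ht => hm.le.trans (hlow t (hss ht)))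
      (fun t ht => le_trans (by gcongr; exact hdist t ht) (hzl t (hss ht)))
    rwa [hpow] at this
  have hcont : ContinuousOn (fun t => Complex.exp (Complex.I * (P 0 t : ℂ))) (Icc a b) :=
    vdc_cont fun t ht => (hP 0 (by omega) t ht).continuousWithinAt
  have hint : ∀ x ∈ Icc a b, ∀ y ∈ Icc a b, IntervalIntegrable
      (fun t => Complex.exp (Complex.I * (P 0 t : ℂ))) volume x y := fun x hx y hy =>
    (hcont.mono (uIcc_subset_Icc hx hy)).intervalIntegrable
  set p := max a (z - δ) with hp
  set q := min b (z + δ) with hq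
  have hap : a ≤ p := le_max_left _ _
  have hqb : q ≤ b := min_le_left _ _
  have hpz : p ≤ z := max_le hz.1 (by linarith)
  have hzq : z ≤ q := le_min hz.2 (by linarith)
  have hpI : p ∈ Icc a b := ⟨hap, hpz.trans hz.2⟩
  have hqI : q ∈ Icc a b := ⟨hz.1.trans hzq, hqb⟩
  have ha : a ∈ Icc a b := ⟨le_rfl, hab⟩
  have hb : b ∈ Icc a b := ⟨hab, le_rfl⟩
  have hcM : (0 : ℝ) ≤ (5 * 2 ^ n - 2) / M := div_nonneg hcnn hM0.le
  have I1 : ‖∫ t in a..p, Complex.exp (Complex.I * (P 0 t : ℂ))‖ ≤ (5 * 2 ^ n - 2) / M := by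
    rcases max_choice a (z - δ) with h | h
    · rw [← hp] at h; rw [h]; simpa using hcM
    · rw [← hp] at h
      refine hsub a p le_rfl hpI.2 hap fun t ht => ?_
      have := ht.2
      rw [h] at this
      exact le_trans (by linarith) (neg_le_abs _)
  have I3 : ‖∫ t in q..b, Complex.exp (Complex.I * (P 0 t : ℂ))‖ ≤ (5 * 2 ^ n - 2) / M := by
    rcases min_choice b (z + δ) with h | h
    · rw [← hq] at h; rw [h]; simpa using hcM
    · rw [← hq] at h
      refine hsub q b hqI.1 le_rfl hqb fun t ht => ?_
      have := ht.1
      rw [h] at this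
      exact le_trans (by linarith) (le_abs_self _)
  have I2 : ‖∫ t in p..q, Complex.exp (Complex.I * (P 0 t : ℂ))‖ ≤ 2 * δ := by
    have := intervalIntegral.norm_integral_le_of_norm_le_const (a := p) (b := q) (C := 1)
      (f := fun t => Complex.exp (Complex.I * (P 0 t : ℂ))) (fun t _ => (vdc_norm _).le)
    rw [one_mul, abs_of_nonneg (by linarith)] at this
    have h1 : z - δ ≤ p := le_max_right _ _
    have h2 : q ≤ z + δ := min_le_right _ _
    linarith
  rw [← intervalIntegral.integral_add_adjacent_intervals (hint a ha q hqI) (hint q hqI b hb),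
    ← intervalIntegral.integral_add_adjacent_intervals (hint a ha p hpI) (hint p hpI q hqI)]
  refine (norm_add₃_le).trans ?_
  have e : (5 * 2 ^ (n + 1) - 2) / M = 2 * ((5 * 2 ^ n - 2) / M) + 2 * δ := by
    rw [hδ]; field_simp; ring
  rw [e]
  linarith

theorem vdc_step {n : ℕ} (hR : VdcR n) (a b m : ℝ) (P : ℕ → ℝ → ℝ) (hab : a ≤ b) (hm : 0 < m)
    (hP : ∀ k < n + 2, ∀ t ∈ Icc a b, HasDerivWithinAt (P k) (P (k + 1) t) (Icc a b) t)
    (hlow : ∀ t ∈ Icc a b, m ≤ |P (n + 2) t|) :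
    ‖∫ t in a..b, Complex.exp (Complex.I * (P 0 t : ℂ))‖ ≤
      (5 * 2 ^ (n + 1) - 2) / m ^ ((1 : ℝ) / (n + 2 : ℕ)) := by
  have hne : ∀ t ∈ Icc a b, P (n + 2) t ≠ 0 := fun t ht h => by
    have := hlow t ht; rw [h, abs_zero] at this; linarith
  rcases hasDerivWithinAt_forall_lt_or_forall_gt_of_forall_ne (convex_Icc a b)
    (hP (n + 1) (by omega)) hne with h | h
  · have := vdc_step_pos hR a b m (fun k t => -P k t) hab hm (fun k hk t ht => (hP k hk t ht).neg)
      (fun t ht => by have := hlow t ht; rwa [abs_of_neg (h t ht)] at this)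
    refine le_trans (le_of_eq ?_) this
    rw [← Complex.norm_conj, intervalIntegral.integral_of_le hab,
      intervalIntegral.integral_of_le hab, ← integral_conj]
    congr 2
    funext t
    simp [← Complex.exp_conj]
  · exact vdc_step_pos hR a b m P hab hm hP
      (fun t ht => by have := hlow t ht; rwa [abs_of_pos (h t ht)] at this)

theorem vdc_R (n : ℕ) : VdcR n := by
  induction n with
  | zero =>
    intro a b m P hab hm hP h2 hlow
    have := vdc_base hab hm (hP 0 (by norm_num)) (hP 1 (by norm_num)) h2 hlow
    refine this.trans (le_of_eq ?_)
    norm_num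
  | succ n ih =>
    intro a b m P hab hm hP _ hlow
    exact vdc_step ih a b m P hab hm (fun k hk => hP k (by omega)) hlow

/-- Integration by parts against an amplitude. -/
theorem vdc_amp {a b C : ℝ} (hab : a ≤ b) {f f' : ℝ → ℝ} {F e : ℝ → ℂ}
    (hf : ∀ t ∈ Icc a b, HasDerivWithinAt f (f' t) (Icc a b) t)
    (hf'int : IntervalIntegrable f' volume a b)
    (he : ContinuousOn e (Icc a b))
    (hF : ∀ t ∈ Icc a b, HasDerivWithinAt F (e t) (Icc a b) t)
    (hFC : ∀ t ∈ Icc a b, ‖F t‖ ≤ C) :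
    ‖∫ t in a..b, (f t : ℂ) * e t‖ ≤
      ‖(f b : ℂ) * F b - (f a : ℂ) * F a‖ + C * ∫ t in a..b, |f' t| := by
  rw [intervalIntegral.integral_mul_deriv_eq_deriv_mul_of_hasDerivWithinAt
    (u := fun t => (f t : ℂ)) (u' := fun t => (f' t : ℂ)) (v := F) (v' := e)
    (by rw [uIcc_of_le hab]; exact fun x hx => (hf x hx).ofReal_comp)
    (by rw [uIcc_of_le hab]; exact hF) ⟨hf'int.1.ofReal, hf'int.2.ofReal⟩
    (by apply ContinuousOn.intervalIntegrable; rwa [uIcc_of_le hab])]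
  refine (norm_sub_le _ _).trans ?_
  gcongr
  rw [← intervalIntegral.integral_const_mul]
  apply intervalIntegral.norm_integral_le_of_norm_le hab _ (hf'int.abs.const_mul C)
  refine Filter.Eventually.of_forall fun t ht => ?_
  rw [norm_mul, Complex.norm_real, mul_comm, Real.norm_eq_abs]
  gcongr
  exact hFC t (Ioc_subset_Icc_self ht)

/-- Van der Corput lemma with amplitude for `d ≥ 2`: `Φ 0 = φ` and `Φ (k+1)` is the derivative
of `Φ k` on `[a,b]` for `k < d`, with `|φ^{(d)}| ≥ ε` on `[a,b]`.  If `f` is differentiable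
with integrable derivative then
`|∫_a^b f(t) e^{iλφ(t)} dt| ≤ (c_d/(λε)^{1/d}) (min(|f a|,|f b|) + ∫|f'|)`
where `c_d = 5·2^{d-1} - 2`. -/
theorem vanDerCorput_amplitude_higher_order
    (a b ε lam : ℝ) (hab : a < b) (d : ℕ) (hd : 2 ≤ d) (hε : 0 < ε) (hlam : 0 < lam)
    (Φ : ℕ → ℝ → ℝ) (f f' : ℝ → ℝ)
    (hΦ : ∀ k < d, ∀ t ∈ Set.Icc a b, HasDerivWithinAt (Φ k) (Φ (k + 1) t) (Set.Icc a b) t)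
    (hΦε : ∀ t ∈ Set.Icc a b, ε ≤ |Φ d t|)
    (hf : ∀ t ∈ Set.Icc a b, HasDerivWithinAt f (f' t) (Set.Icc a b) t)
    (hf'int : IntervalIntegrable f' volume a b) :
    ‖∫ t in a..b, (f t : ℂ) * Complex.exp (Complex.I * (lam : ℂ) * (Φ 0 t : ℂ))‖ ≤
      ((5 * 2 ^ (d - 1) - 2 : ℝ) / (lam * ε) ^ ((1 : ℝ) / d)) *
        (min |f a| |f b| + ∫ t in a..b, |f' t|) := by
  obtain ⟨n, rfl⟩ : ∃ n, d = n + 2 := ⟨d - 2, by omega⟩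
  have hm : 0 < lam * ε := mul_pos hlam hε
  set C : ℝ := (5 * 2 ^ (n + 2 - 1) - 2 : ℝ) / (lam * ε) ^ ((1 : ℝ) / (n + 2 : ℕ)) with hC
  set e : ℝ → ℂ := fun t => Complex.exp (Complex.I * ((lam * Φ 0 t : ℝ) : ℂ)) with he
  have hcong : ∀ t, Complex.exp (Complex.I * (lam : ℂ) * (Φ 0 t : ℂ)) = e t := fun t => by
    simp only [he]; push_cast; rw [mul_assoc]
  simp_rw [hcong]
  have hbound : ∀ x y, a ≤ x → y ≤ b → x ≤ y → ‖∫ t in x..y, e t‖ ≤ C := by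
    intro x y hx hy hxy
    have hss : Icc x y ⊆ Icc a b := Icc_subset_Icc hx hy
    exact vdc_step (vdc_R n) x y (lam * ε) (fun k t => lam * Φ k t) hxy hm
      (fun k hk t ht => ((hΦ k hk t (hss ht)).mono hss).const_mul lam)
      (fun t ht => by
        rw [abs_mul, abs_of_pos hlam]
        exact mul_le_mul_of_nonneg_left (hΦε t (hss ht)) hlam.le)
  have hec : ContinuousOn e (Icc a b) := vdc_cont
    (continuousOn_const.mul fun t ht => (hΦ 0 (by omega) t ht).continuousWithinAt)
  have hei : IntervalIntegrable e volume a b := by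
    apply ContinuousOn.intervalIntegrable; rwa [uIcc_of_le hab.le]
  have hsubi : ∀ x ∈ Icc a b, ∀ y ∈ Icc a b, IntervalIntegrable e volume x y := fun x hx y hy =>
    (hec.mono (uIcc_subset_Icc hx hy)).intervalIntegrable
  have ha : a ∈ Icc a b := ⟨le_rfl, hab.le⟩
  have hb : b ∈ Icc a b := ⟨hab.le, le_rfl⟩
  set F : ℝ → ℂ := fun x => ∫ t in a..x, e t with hFdef
  have hF : ∀ t ∈ Icc a b, HasDerivWithinAt F (e t) (Icc a b) t := by
    intro t ht
    have : Fact (t ∈ Icc a b) := ⟨ht⟩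
    exact intervalIntegral.integral_hasDerivWithinAt_right (s := Icc a b) (t := Icc a b)
      (hsubi a ha t ht)
      (hec.stronglyMeasurableAtFilter_nhdsWithin measurableSet_Icc t) (hec t ht)
  have hI0 : 0 ≤ ∫ t in a..b, |f' t| :=
    intervalIntegral.integral_nonneg hab.le fun t _ => abs_nonneg _
  rcases min_choice |f a| |f b| with h | h
  · rw [h]
    have := vdc_amp (C := C) hab.le hf hf'int hec (F := fun x => F x - F b)
      (fun t ht => (hF t ht).sub_const (F b)) (fun t ht => by
        have e1 : F t + ∫ s in t..b, e s = F b :=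
          intervalIntegral.integral_add_adjacent_intervals (hsubi a ha t ht) (hsubi t ht b hb)
        rw [norm_sub_rev, ← e1, add_sub_cancel_left]
        exact hbound t b ht.1 le_rfl ht.2)
    refine this.trans ?_
    have e2 : F a = 0 := by simp [hFdef]
    have e3 : ‖F b‖ ≤ C := hbound a b le_rfl le_rfl hab.le
    have e4 : ‖(f b : ℂ) * (F b - F b) - (f a : ℂ) * (F a - F b)‖ = ‖F b‖ * |f a| := by
      rw [e2]; simp [mul_comm]
    rw [e4, mul_add]
    gcongr
  · rw [h]
    have := vdc_amp (C := C) hab.le hf hf'int hec hF (fun t ht => hbound a t le_rfl ht.2 ht.1)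
    refine this.trans ?_
    have e2 : F a = 0 := by simp [hFdef]
    have e3 : ‖F b‖ ≤ C := hbound a b le_rfl le_rfl hab.le
    have e4 : ‖(f b : ℂ) * F b - (f a : ℂ) * F a‖ = ‖F b‖ * |f b| := by
      rw [e2]; simp [mul_comm]
    rw [e4, mul_add]
    gcongr
end

section
/- Let a < b be real numbers and let f : (a,b) → ℝ be differentiable such that the one-sided limits f(a^+) = lim_{t→a^+} f(t) and f(b^-) = lim_{t→b^-} f(t) exist in ℝ, and such that f' has constant sign on (a,b), i.e., either f'(t) ≥ 0 for all t ∈ (a,b) or f'(t) ≤ 0 for all t ∈ (a,b). Then f' is Lebesgue integrable on (a,b) and ∫_a^b f'(t) dt = f(b^-) − f(a^+). -/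
open MeasureTheory Set Filter

theorem nonneg_deriv_integrable_aux
    (a b : ℝ) (hab : a < b) (f f' : ℝ → ℝ) (A B : ℝ)
    (hderiv : ∀ t ∈ Set.Ioo a b, HasDerivAt f (f' t) t)
    (hA : Filter.Tendsto f (nhdsWithin a (Set.Ioi a)) (nhds A))
    (hB : Filter.Tendsto f (nhdsWithin b (Set.Iio b)) (nhds B))
    (hpos : ∀ t ∈ Set.Ioo a b, 0 ≤ f' t) :
    MeasureTheory.IntegrableOn f' (Set.Ioc a b) := by
  have hc : ContinuousOn f (Set.Ioo a b) :=
    fun t ht => (hderiv t ht).continuousAt.continuousWithinAt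
  refine intervalIntegral.integrableOn_deriv_of_nonneg
    (continuousOn_Icc_extendFrom_Ioo hc hA hB) (fun x hx => ?_) hpos
  refine (hderiv x hx).congr_of_eventuallyEq ?_
  filter_upwards [Ioo_mem_nhds hx.1 hx.2] with y hy
  exact extendFrom_eq (subset_closure hy) (hc y hy)

/-- Fundamental theorem of calculus for a differentiable function on `(a,b)` whose derivative
has constant sign and whose one-sided limits at the endpoints exist: the derivative is
Lebesgue integrable on `(a,b)` and its integral equals `f(b⁻) - f(a⁺)`. -/
theorem integral_deriv_of_constant_sign
    (a b : ℝ) (hab : a < b) (f f' : ℝ → ℝ) (A B : ℝ)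
    (hderiv : ∀ t ∈ Set.Ioo a b, HasDerivAt f (f' t) t)
    (hA : Filter.Tendsto f (nhdsWithin a (Set.Ioi a)) (nhds A))
    (hB : Filter.Tendsto f (nhdsWithin b (Set.Iio b)) (nhds B))
    (hsign : (∀ t ∈ Set.Ioo a b, 0 ≤ f' t) ∨ (∀ t ∈ Set.Ioo a b, f' t ≤ 0)) :
    MeasureTheory.IntegrableOn f' (Set.Ioo a b) ∧
      ∫ t in Set.Ioo a b, f' t = B - A := by
  have hint : MeasureTheory.IntegrableOn f' (Set.Ioc a b) := by
    rcases hsign with h | h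
    · exact nonneg_deriv_integrable_aux a b hab f f' A B hderiv hA hB h
    · have := nonneg_deriv_integrable_aux a b hab (-f) (-f') (-A) (-B)
        (fun t ht => (hderiv t ht).neg) hA.neg hB.neg
        (fun t ht => neg_nonneg.mpr (h t ht))
      simpa using this.neg
  refine ⟨hint.mono_set Ioo_subset_Ioc_self, ?_⟩
  rw [← integral_Ioc_eq_integral_Ioo, ← intervalIntegral.integral_of_le hab.le]
  exact intervalIntegral.integral_eq_sub_of_hasDerivAt_of_tendsto hab hderiv
    ((intervalIntegrable_iff_integrableOn_Ioc_of_le hab.le).mpr hint) hA hB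
end

section
/- Let a < b be real numbers. Let f : (a,b) → ℝ be differentiable and Lebesgue integrable on (a,b), such that the one-sided limits f(a^+) = lim_{t→a^+} f(t) and f(b^-) = lim_{t→b^-} f(t) exist in ℝ, and such that f' has constant sign on (a,b), i.e., either f'(t) ≥ 0 for all t ∈ (a,b) or f'(t) ≤ 0 for all t ∈ (a,b). Let g : (a,b) → ℂ be differentiable such that g and g' are bounded and such that the one-sided limits g(a^+) and g(b^-) exist in ℂ. Then f·g' and f'·g are Lebesgue integrable on (a,b), and ∫_a^b f(t) g'(t) dt = ( f(b^-) g(b^-) − f(a^+) g(a^+) ) − ∫_a^b f'(t) g(t) dt. -/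
open MeasureTheory Set Filter

theorem aux_deriv_integrable {a b : ℝ} (hab : a < b) {f f' : ℝ → ℝ} {fa fb : ℝ}
    (hderiv : ∀ x ∈ Ioo a b, HasDerivAt f (f' x) x)
    (ha : Tendsto f (nhdsWithin a (Ioi a)) (nhds fa))
    (hb : Tendsto f (nhdsWithin b (Iio b)) (nhds fb))
    (hpos : ∀ x ∈ Ioo a b, 0 ≤ f' x) : IntegrableOn f' (Ioo a b) := by
  set F : ℝ → ℝ := Function.update (Function.update f a fa) b fb with hF
  have Fderiv : ∀ x ∈ Ioo a b, HasDerivAt F (f' x) x := by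
    refine fun x hx => (hderiv x hx).congr_of_eventuallyEq ?_
    filter_upwards [Ioo_mem_nhds hx.1 hx.2] with _ hy
    unfold F
    rw [Function.update_of_ne hy.2.ne, Function.update_of_ne hy.1.ne']
  have hcont : ContinuousOn F (Icc a b) := by
    rw [continuousOn_update_iff, continuousOn_update_iff, Icc_sdiff_right, Ico_sdiff_left]
    refine ⟨⟨fun z hz => (hderiv z hz).continuousAt.continuousWithinAt, ?_⟩, ?_⟩
    · exact fun _ => ha.mono_left (nhdsWithin_mono _ Ioo_subset_Ioi_self)
    · rintro -
      refine (hb.congr' ?_).mono_left (nhdsWithin_mono _ Ico_subset_Iio_self)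
      filter_upwards [Ioo_mem_nhdsLT hab] with _ hz using
        (Function.update_of_ne hz.1.ne' _ _).symm
  exact (intervalIntegral.integrableOn_deriv_of_nonneg hcont Fderiv hpos).mono_set
    Ioo_subset_Ioc_self

/-- Integration by parts on `(a,b)`: `f` is real-valued, differentiable, integrable, with
one-sided limits at the endpoints and derivative of constant sign; `g` is complex-valued,
differentiable, with `g` and `g'` bounded and one-sided limits at the endpoints.  Then
`f·g'` and `f'·g` are Lebesgue integrable on `(a,b)` and
`∫ f g' = (f(b⁻)g(b⁻) - f(a⁺)g(a⁺)) - ∫ f' g`. -/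
theorem integration_by_parts_Ioo
    (a b : ℝ) (hab : a < b) (f f' : ℝ → ℝ) (g g' : ℝ → ℂ)
    (Af Bf : ℝ) (Ag Bg : ℂ)
    (hfderiv : ∀ t ∈ Set.Ioo a b, HasDerivAt f (f' t) t)
    (hfint : MeasureTheory.IntegrableOn f (Set.Ioo a b))
    (hfA : Filter.Tendsto f (nhdsWithin a (Set.Ioi a)) (nhds Af))
    (hfB : Filter.Tendsto f (nhdsWithin b (Set.Iio b)) (nhds Bf))
    (hsign : (∀ t ∈ Set.Ioo a b, 0 ≤ f' t) ∨ (∀ t ∈ Set.Ioo a b, f' t ≤ 0))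
    (hgderiv : ∀ t ∈ Set.Ioo a b, HasDerivAt g (g' t) t)
    (hgbdd : ∃ C : ℝ, ∀ t ∈ Set.Ioo a b, ‖g t‖ ≤ C)
    (hg'bdd : ∃ C : ℝ, ∀ t ∈ Set.Ioo a b, ‖g' t‖ ≤ C)
    (hgA : Filter.Tendsto g (nhdsWithin a (Set.Ioi a)) (nhds Ag))
    (hgB : Filter.Tendsto g (nhdsWithin b (Set.Iio b)) (nhds Bg)) :
    MeasureTheory.IntegrableOn (fun t => (f t : ℂ) * g' t) (Set.Ioo a b) ∧
    MeasureTheory.IntegrableOn (fun t => (f' t : ℂ) * g t) (Set.Ioo a b) ∧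
    ∫ t in Set.Ioo a b, (f t : ℂ) * g' t =
      ((Bf : ℂ) * Bg - (Af : ℂ) * Ag) - ∫ t in Set.Ioo a b, (f' t : ℂ) * g t := by
  obtain ⟨C, hC⟩ := hgbdd
  obtain ⟨D, hD⟩ := hg'bdd
  have hf' : IntegrableOn f' (Ioo a b) := by
    rcases hsign with h | h
    · exact aux_deriv_integrable hab hfderiv hfA hfB h
    · have := aux_deriv_integrable hab (f := fun x => -f x) (f' := fun x => -f' x)
        (fun x hx => (hfderiv x hx).fun_neg) hfA.neg hfB.neg
        (fun x hx => neg_nonneg.2 (h x hx))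
      simpa using this.neg
  have hgc : ContinuousOn g (Ioo a b) :=
    fun z hz => (hgderiv z hz).continuousAt.continuousWithinAt
  have mg : AEStronglyMeasurable g (volume.restrict (Ioo a b)) :=
    hgc.aestronglyMeasurable measurableSet_Ioo
  have mg' : AEStronglyMeasurable g' (volume.restrict (Ioo a b)) := by
    refine (aestronglyMeasurable_deriv g _).congr ?_
    filter_upwards [ae_restrict_mem measurableSet_Ioo] with x hx using (hgderiv x hx).deriv
  have h1 : IntegrableOn (fun t => (f t : ℂ) * g' t) (Ioo a b) := by
    refine Integrable.mul_bdd (c := D) hfint.ofReal mg' ?_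
    filter_upwards [ae_restrict_mem measurableSet_Ioo] with x hx using hD x hx
  have h2 : IntegrableOn (fun t => (f' t : ℂ) * g t) (Ioo a b) := by
    refine Integrable.mul_bdd (c := C) hf'.ofReal mg ?_
    filter_upwards [ae_restrict_mem measurableSet_Ioo] with x hx using hC x hx
  refine ⟨h1, h2, ?_⟩
  have key := intervalIntegral.integral_eq_sub_of_hasDerivAt_of_tendsto hab
    (f := fun t => (f t : ℂ) * g t) (f' := fun t => (f' t : ℂ) * g t + (f t : ℂ) * g' t)
    (fun x hx => (hfderiv x hx).ofReal_comp.mul (hgderiv x hx))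
    ((intervalIntegrable_iff_integrableOn_Ioo_of_le hab.le).2 (h2.add h1))
    (((Complex.continuous_ofReal.tendsto _).comp hfA).mul hgA)
    (((Complex.continuous_ofReal.tendsto _).comp hfB).mul hgB)
  rw [intervalIntegral.integral_of_le hab.le, integral_Ioc_eq_integral_Ioo,
    integral_add h2 h1] at key
  rw [← key]; ring
end

section
/- Let f : ℝ → ℝ be continuous and Lebesgue integrable, and suppose there exist finitely many points a_1 < a_2 < ⋯ < a_n in ℝ such that on each of the open intervals (−∞, a_1), (a_1, a_2), …, (a_{n−1}, a_n), (a_n, +∞), the function f is differentiable with derivative of constant sign (i.e., on each such interval, either f' ≥ 0 throughout or f' ≤ 0 throughout). Then: (i) f(y) → 0 as |y| → ∞; (ii) the almost-everywhere defined derivative f' is Lebesgue integrable on ℝ; and (iii) for every z ∈ ℝ, iz · ∫_ℝ f(y) e^{−iyz} dy = ∫_ℝ f'(y) e^{−iyz} dy. Equivalently, √(2π) · iz · f̂(z) = ∫_ℝ f'(y) e^{−iyz} dy, where f̂(z) = (1/√(2π)) ∫_ℝ f(y) e^{−iyz} dy denotes the Fourier transform of f. -/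
open MeasureTheory Set Filter

lemma aux_exists_small (f : ℝ → ℝ) (hint : Integrable f) (x c : ℝ) (hc : 0 < c) :
    ∃ y, x ≤ y ∧ |f y| < c := by
  by_contra! h
  have h1 := hint.measure_norm_ge_lt_top hc
  have h2 : (volume : Measure ℝ) (Ici x) ≤ volume {a | c ≤ ‖f a‖} :=
    measure_mono (fun y hy => by simpa using h y hy)
  simp at h2
  exact absurd h2 h1.ne

lemma aux_mono (f : ℝ → ℝ) (hint : Integrable f) (M : ℝ) (hm : MonotoneOn f (Ici M)) :
    Tendsto f atTop (nhds 0) := by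
  have hle : ∀ x, M ≤ x → f x ≤ 0 := by
    intro x hx
    by_contra! h
    obtain ⟨y, hy, hy'⟩ := aux_exists_small f hint x (f x) h
    have := hm (mem_Ici.2 hx) (mem_Ici.2 (hx.trans hy)) hy
    have := le_abs_self (f y)
    linarith
  rw [Metric.tendsto_atTop]
  intro e he
  obtain ⟨y, hy, hy'⟩ := aux_exists_small f hint M e he
  refine ⟨y, fun t ht => ?_⟩
  have h1 := hm (mem_Ici.2 hy) (mem_Ici.2 (hy.trans ht)) ht
  have h2 := hle t (hy.trans ht)
  rw [Real.dist_eq, sub_zero, abs_lt]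
  rw [abs_lt] at hy'
  constructor <;> linarith

lemma aux_half_nonneg (f f' : ℝ → ℝ) (hf : Continuous f) (hint : Integrable f) (M : ℝ)
    (hd : ∀ t ∈ Ioi M, HasDerivAt f (f' t) t) (hs : ∀ t ∈ Ioi M, 0 ≤ f' t) :
    Tendsto f atTop (nhds 0) ∧ IntegrableOn f' (Ioi M) := by
  have hm : MonotoneOn f (Ici M) := by
    apply monotoneOn_of_deriv_nonneg (convex_Ici M) hf.continuousOn
    · intro t ht
      rw [interior_Ici] at ht
      exact (hd t ht).differentiableAt.differentiableWithinAt
    · intro t ht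
      rw [interior_Ici] at ht
      rw [(hd t ht).deriv]
      exact hs t ht
  have ht := aux_mono f hint M hm
  exact ⟨ht, integrableOn_Ioi_deriv_of_nonneg hf.continuousWithinAt hd hs ht⟩

lemma aux_half (f f' : ℝ → ℝ) (hf : Continuous f) (hint : Integrable f) (M : ℝ)
    (hd : ∀ t ∈ Ioi M, HasDerivAt f (f' t) t)
    (hs : ∀ y, M < y → ((∀ t ∈ Ioo M y, 0 ≤ f' t) ∨ (∀ t ∈ Ioo M y, f' t ≤ 0))) :
    Tendsto f atTop (nhds 0) ∧ IntegrableOn f' (Ioi M) := by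
  have hs' : (∀ t ∈ Ioi M, 0 ≤ f' t) ∨ (∀ t ∈ Ioi M, f' t ≤ 0) := by
    by_contra! h
    obtain ⟨⟨t, ht, ht'⟩, s, hs1, hs'⟩ := h
    rw [mem_Ioi] at ht hs1
    have h1 : t < max t s + 1 := by linarith [le_max_left t s]
    have h2 : s < max t s + 1 := by linarith [le_max_right t s]
    rcases hs (max t s + 1) (ht.trans h1) with h | h
    · linarith [h t ⟨ht, h1⟩]
    · linarith [h s ⟨hs1, h2⟩]
  rcases hs' with h | h
  · exact aux_half_nonneg f f' hf hint M hd h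
  · have := aux_half_nonneg (fun t => -f t) (fun t => -f' t) hf.neg hint.neg M
      (fun t ht => (hd t ht).neg) (fun t ht => neg_nonneg.2 (h t ht))
    refine ⟨by simpa using this.1.neg, by simpa using this.2.neg⟩

lemma aux_bdd (f f' : ℝ → ℝ) (hf : Continuous f) (x y : ℝ)
    (hd : ∀ t ∈ Ioo x y, HasDerivAt f (f' t) t)
    (hs : (∀ t ∈ Ioo x y, 0 ≤ f' t) ∨ (∀ t ∈ Ioo x y, f' t ≤ 0)) :
    IntegrableOn f' (Ioc x y) := by
  rcases hs with h | h
  · exact intervalIntegral.integrableOn_deriv_of_nonneg hf.continuousOn hd h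
  · have := intervalIntegral.integrableOn_deriv_of_nonneg (g := fun t => -f t)
      (g' := fun t => -f' t) (a := x) (b := y) hf.neg.continuousOn
      (fun t ht => (hd t ht).neg) (fun t ht => neg_nonneg.2 (h t ht))
    simpa using this.neg

/-- Let `f : ℝ → ℝ` be continuous and integrable, differentiable off finitely many points
`a 0 < a 1 < ⋯ < a (n-1)` with (measurable, a.e.-defined) derivative `f'` of constant sign on
each open interval avoiding these points.  Then `f` tends to `0` at `±∞`, `f'` is Lebesgue
integrable, and for every `z ∈ ℝ`, `iz ∫ f(y) e^{-iyz} dy = ∫ f'(y) e^{-iyz} dy`. -/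
theorem fourier_deriv_formula_piecewise_monotone
    (f f' : ℝ → ℝ) (hf : Continuous f) (hint : MeasureTheory.Integrable f)
    (n : ℕ) (a : Fin n → ℝ) (ha : StrictMono a)
    (hmeas : Measurable f')
    (hderiv : ∀ t : ℝ, (∀ i, a i ≠ t) → HasDerivAt f (f' t) t)
    (hsign : ∀ x y : ℝ, x < y → (∀ i, a i ∉ Set.Ioo x y) →
      ((∀ t ∈ Set.Ioo x y, 0 ≤ f' t) ∨ (∀ t ∈ Set.Ioo x y, f' t ≤ 0))) :
    (Filter.Tendsto f Filter.atTop (nhds 0) ∧ Filter.Tendsto f Filter.atBot (nhds 0)) ∧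
    MeasureTheory.Integrable f' ∧
    ∀ z : ℝ,
      Complex.I * (z : ℂ) * ∫ y : ℝ, (f y : ℂ) * Complex.exp (-(Complex.I * (y : ℂ) * (z : ℂ))) =
        ∫ y : ℝ, (f' y : ℂ) * Complex.exp (-(Complex.I * (y : ℂ) * (z : ℂ))) := by
  have hfin : (range a).Finite := finite_range a
  obtain ⟨M, hM⟩ : ∃ M, ∀ i, |a i| ≤ M := by
    obtain ⟨M, hM⟩ := (finite_range (fun i => |a i|)).bddAbove
    exact ⟨M, fun i => hM ⟨i, rfl⟩⟩
  have hM1 : ∀ i, a i ≤ M := fun i => (abs_le.1 (hM i)).2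
  have hM2 : ∀ i, -M ≤ a i := fun i => (abs_le.1 (hM i)).1
  have hR := aux_half f f' hf hint M
    (fun t ht => hderiv t (fun i => ((hM1 i).trans_lt ht).ne))
    (fun y hy => hsign M y hy (fun i hi => absurd hi.1 (not_lt.2 (hM1 i))))
  have hL := aux_half (fun t => f (-t)) (fun t => -f' (-t)) (hf.comp continuous_neg)
    hint.comp_neg M
    (fun t ht => by
      have h := hderiv (-t) (fun i => by
        have := hM2 i
        rw [mem_Ioi] at ht
        intro h
        linarith)
      have h2 := h.scomp t (hasDerivAt_neg t)
      simp only [smul_eq_mul, neg_mul, one_mul] at h2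
      exact h2)
    (fun y hy => by
      rcases hsign (-y) (-M) (by linarith)
        (fun i hi => absurd hi.2 (not_lt.2 (hM2 i))) with h | h
      · right
        intro t ht
        have := h (-t) ⟨by linarith [ht.2], by linarith [ht.1]⟩
        linarith
      · left
        intro t ht
        have := h (-t) ⟨by linarith [ht.2], by linarith [ht.1]⟩
        linarith)
  have htop := hR.1
  have hbot : Tendsto f atBot (nhds 0) := by
    have := hL.1.comp tendsto_neg_atBot_atTop
    simpa [Function.comp_def] using this
  have hI1 : IntegrableOn f' (Iio (-M)) := by
    have h := hL.2.neg
    have h2 : IntegrableOn (fun t => f' (-t)) (Ioi M) := by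
      refine h.congr_fun (fun t _ => by simp) measurableSet_Ioi
    have h3 := h2.comp_neg
    simpa using h3
  have hI2 : IntegrableOn f' (Icc (-M) M) := by
    have hloc : LocallyIntegrable f' := by
      intro x
      have hn : (range a \ {x})ᶜ ∈ nhds x :=
        (hfin.subset sdiff_subset).isClosed.isOpen_compl.mem_nhds (by simp)
      obtain ⟨e, he, hball⟩ := Metric.mem_nhds_iff.1 hn
      have key : ∀ t, |t - x| < e → t ≠ x → ∀ i, a i ≠ t := by
        intro t ht htx i hi
        exact hball (show t ∈ Metric.ball x e by rwa [Metric.mem_ball, Real.dist_eq])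
          ⟨⟨i, hi⟩, htx⟩
      have k1 : ∀ t ∈ Ioo x (x + e), ∀ i, a i ≠ t := fun t ht =>
        key t (by rw [abs_lt]; constructor <;> linarith [ht.1, ht.2]) ht.1.ne'
      have k2 : ∀ t ∈ Ioo (x - e) x, ∀ i, a i ≠ t := fun t ht =>
        key t (by rw [abs_lt]; constructor <;> linarith [ht.1, ht.2]) ht.2.ne
      have i1 := aux_bdd f f' hf x (x + e) (fun t ht => hderiv t (k1 t ht))
        (hsign _ _ (by linarith) (fun i hi => k1 _ hi i rfl))
      have i2 := aux_bdd f f' hf (x - e) x (fun t ht => hderiv t (k2 t ht))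
        (hsign _ _ (by linarith) (fun i hi => k2 _ hi i rfl))
      refine ⟨Ioc (x - e) (x + e), Ioc_mem_nhds (by linarith) (by linarith), ?_⟩
      rw [← Ioc_union_Ioc_eq_Ioc (b := x) (by linarith) (by linarith)]
      exact i2.union i1
    exact hloc.integrableOn_isCompact isCompact_Icc
  have hI : Integrable f' := by
    rw [← integrableOn_univ]
    refine ((hI1.union hI2).union hR.2).mono_set ?_
    intro t _
    by_cases h1 : t < -M
    · exact Or.inl (Or.inl h1)
    · by_cases h2 : M < t
      · exact Or.inr h2
      · exact Or.inl (Or.inr ⟨not_lt.1 h1, not_lt.1 h2⟩)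
  refine ⟨⟨htop, hbot⟩, hI, fun z => ?_⟩
  set E : ℝ → ℂ := fun y => Complex.exp (-(Complex.I * (y : ℂ) * (z : ℂ))) with hE
  have hEc : Continuous E := by fun_prop
  have hEn : ∀ y, ‖E y‖ = 1 := by
    intro y
    have : E y = Complex.exp (((-(y * z) : ℝ) : ℂ) * Complex.I) := by
      simp only [hE]; congr 1; push_cast; ring
    rw [this, Complex.norm_exp_ofReal_mul_I]
  have hEd : ∀ y, HasDerivAt E (-(Complex.I * z) * E y) y := by
    intro y
    have h1 : HasDerivAt (fun y : ℝ => -(Complex.I * (y : ℂ) * (z : ℂ))) (-(Complex.I * z)) y := by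
      have := (((hasDerivAt_id y).ofReal_comp.const_mul Complex.I).mul_const (z : ℂ)).neg
      simp only [id_eq, Complex.ofReal_one, mul_one] at this
      exact this
    have := h1.cexp
    rwa [mul_comm] at this
  have hmul : ∀ g : ℝ → ℝ, Integrable g → Integrable (fun y => (g y : ℂ) * E y) := by
    intro g hg
    exact hg.ofReal.mul_bdd (c := 1) hEc.aestronglyMeasurable
      (Eventually.of_forall fun y => (hEn y).le)
  have hA := hmul f hint
  have hB := hmul f' hI
  set G : ℝ → ℂ := fun y => (f' y : ℂ) * E y - Complex.I * z * ((f y : ℂ) * E y) with hG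
  have hGi : Integrable G := hB.sub (hA.const_mul _)
  have hFd : ∀ y, (∀ i, a i ≠ y) → HasDerivAt (fun y => (f y : ℂ) * E y) (G y) y := by
    intro y hy
    have := (hderiv y hy).ofReal_comp.mul (hEd y)
    refine HasDerivAt.congr_deriv this ?_
    simp only [hG]; ring
  have hF0 : ∀ l : Filter ℝ, Tendsto f l (nhds 0) →
      Tendsto (fun y => (f y : ℂ) * E y) l (nhds 0) := by
    intro l hl
    rw [tendsto_zero_iff_norm_tendsto_zero]
    simpa [hEn] using hl.abs
  have hlim1 : Tendsto (fun r : ℝ => ∫ y in (-r)..r, G y) atTop (nhds (∫ y, G y)) :=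
    intervalIntegral_tendsto_integral hGi tendsto_neg_atTop_atBot tendsto_id
  have hlim2 : Tendsto (fun r : ℝ => ∫ y in (-r)..r, G y) atTop (nhds 0) := by
    have h1 : ∀ r : ℝ, ∫ y in (-r)..r, G y = (f r : ℂ) * E r - (f (-r) : ℂ) * E (-r) := by
      intro r
      refine integral_eq_of_hasDerivAt_off_countable (fun y => (f y : ℂ) * E y) G
        hfin.countable ?_ ?_ hGi.intervalIntegrable
      · exact (by fun_prop : Continuous (fun y => (f y : ℂ) * E y)).continuousOn
      · intro y hy
        exact hFd y (fun i hi => hy.2 ⟨i, hi⟩)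
    simp only [h1]
    have := (hF0 _ htop).sub ((hF0 _ hbot).comp tendsto_neg_atTop_atBot)
    simpa using this
  have h0 := tendsto_nhds_unique hlim1 hlim2
  simp only [hG] at h0
  rw [integral_sub hB (hA.const_mul _), integral_const_mul, sub_eq_zero] at h0
  exact h0.symm
end

section
/- Let k, m, M be positive integers and let A ⊆ ℝ^k × (0,∞)^m be a set such that for each x ∈ ℝ^k the fiber A_x = { y ∈ (0,∞)^m : (x,y) ∈ A } is open in ℝ^m. Let c_1, …, c_M : ℝ^k → (0,∞) be functions, let μ_1, …, μ_M ∈ ℚ^m, and define φ : A → (0,∞)^M by φ(x,y) = ( c_1(x) y^{μ_1}, …, c_M(x) y^{μ_M} ), where y^{μ} = y_1^{μ_1} ⋯ y_m^{μ_m} with real-valued (rational) exponents. Assume that φ is bounded on A, and let F : V → ℝ be a real-analytic function on an open set V ⊆ ℝ^M containing the closure of φ(A). Set f = F ∘ φ : A → ℝ. Then for each l ∈ {1, …, m}, the function (x,y) ↦ y_l · (∂f/∂y_l)(x,y) is bounded on A, where ∂f/∂y_l denotes the partial derivative of y ↦ f(x,y) in the l-th coordinate of y. -/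
open MeasureTheory Set

/-- Let `A ⊆ ℝ^k × (0,∞)^m` have open fibers over `ℝ^k`, let
`φ(x,y) = (c_1(x) y^{μ_1}, …, c_M(x) y^{μ_M})` be a bounded rational monomial map on `A`
(with `c_j > 0` and rational exponents `μ_j`), and let `F` be real-analytic on an open set
`V` containing the closure of `φ(A)`.  Then for each `l`, the function
`(x,y) ↦ y_l ∂(F∘φ)/∂y_l (x,y)` is bounded on `A`. -/
theorem monomial_weighted_partial_deriv_bounded
    (k m M : ℕ) (hk : 0 < k) (hm : 0 < m) (hM : 0 < M)
    (A : Set ((Fin k → ℝ) × (Fin m → ℝ)))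
    (hpos : ∀ p ∈ A, ∀ i : Fin m, (0 : ℝ) < p.2 i)
    (hopen : ∀ x : Fin k → ℝ, IsOpen {y : Fin m → ℝ | (x, y) ∈ A})
    (c : Fin M → (Fin k → ℝ) → ℝ) (hc : ∀ j x, 0 < c j x)
    (μ : Fin M → Fin m → ℚ)
    (hbdd : ∃ C : ℝ, ∀ p ∈ A, ∀ j : Fin M,
      c j p.1 * ∏ i, p.2 i ^ ((μ j i : ℝ)) ≤ C)
    (V : Set (Fin M → ℝ)) (hV : IsOpen V)
    (hclos : closure ((fun p : (Fin k → ℝ) × (Fin m → ℝ) =>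
      fun j : Fin M => c j p.1 * ∏ i, p.2 i ^ ((μ j i : ℝ))) '' A) ⊆ V)
    (F : (Fin M → ℝ) → ℝ) (hF : AnalyticOnNhd ℝ F V) :
    ∀ l : Fin m, ∃ C : ℝ, ∀ p ∈ A,
      |p.2 l * deriv (fun s : ℝ =>
        F (fun j : Fin M => c j p.1 * ∏ i, (Function.update p.2 l s) i ^ ((μ j i : ℝ))))
        (p.2 l)| ≤ C := by
  intro l
  obtain ⟨C, hC⟩ := hbdd
  set φ : (Fin k → ℝ) × (Fin m → ℝ) → (Fin M → ℝ) := fun p =>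
      fun j : Fin M => c j p.1 * ∏ i, p.2 i ^ ((μ j i : ℝ)) with hφ
  have hφpos : ∀ p ∈ A, ∀ j, 0 < φ p j := fun p hp j =>
    mul_pos (hc j p.1) (Finset.prod_pos fun i _ => Real.rpow_pos_of_pos (hpos p hp i) _)
  have hφb : ∀ p ∈ A, ∀ j, |φ p j| ≤ |C| := fun p hp j => by
    rw [abs_of_pos (hφpos p hp j)]
    exact (hC p hp j).trans (le_abs_self C)
  have hsub : φ '' A ⊆ Metric.closedBall 0 |C| := by
    rintro _ ⟨p, hp, rfl⟩
    rw [mem_closedBall_zero_iff, pi_norm_le_iff_of_nonneg (abs_nonneg C)]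
    exact fun j => hφb p hp j
  have hK : IsCompact (closure (φ '' A)) :=
    (Metric.isBounded_closedBall.subset hsub).isCompact_closure
  obtain ⟨B, hB⟩ := hK.exists_bound_of_continuousOn (hF.fderiv.continuousOn.mono hclos)
  refine ⟨|B| * ∑ j, |(μ j l : ℝ)| * |C|, fun p hp => ?_⟩
  have hyl := hpos p hp l
  have hmem : φ p ∈ closure (φ '' A) := subset_closure ⟨p, hp, rfl⟩
  have hcurve : HasDerivAt (fun s : ℝ => fun j : Fin M =>
      c j p.1 * ∏ i, (Function.update p.2 l s) i ^ ((μ j i : ℝ)))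
      (fun j => (p.2 l)⁻¹ * ((μ j l : ℝ) * φ p j)) (p.2 l) := by
    rw [hasDerivAt_pi]
    intro j
    have h1 : ∀ s : ℝ, ∏ i, (Function.update p.2 l s) i ^ ((μ j i : ℝ))
        = s ^ (μ j l : ℝ) * ∏ i ∈ Finset.univ.erase l, p.2 i ^ ((μ j i : ℝ)) := by
      intro s
      rw [← Finset.mul_prod_erase Finset.univ _ (Finset.mem_univ l), Function.update_self]
      congr 1
      refine Finset.prod_congr rfl fun i hi => ?_
      rw [Function.update_of_ne (Finset.ne_of_mem_erase hi)]
    have h2 : φ p j = c j p.1 * ((p.2 l) ^ (μ j l : ℝ) *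
        ∏ i ∈ Finset.univ.erase l, p.2 i ^ ((μ j i : ℝ))) := by
      rw [← h1, Function.update_eq_self]
    simp only [h1]
    rw [h2]
    have h3 := (((Real.hasDerivAt_rpow_const (p := (μ j l : ℝ)) (Or.inl hyl.ne')).mul_const
      (∏ i ∈ Finset.univ.erase l, p.2 i ^ ((μ j i : ℝ)))).const_mul (c j p.1))
    refine h3.congr_deriv ?_
    rw [Real.rpow_sub_one hyl.ne']
    field_simp
  have hval : (fun j : Fin M =>
      c j p.1 * ∏ i, (Function.update p.2 l (p.2 l)) i ^ ((μ j i : ℝ))) = φ p := by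
    rw [Function.update_eq_self]
  have hFd : HasFDerivAt F (fderiv ℝ F (φ p)) (φ p) :=
    (hF _ (hclos hmem)).differentiableAt.hasFDerivAt
  have hd := (HasFDerivAt.comp_hasDerivAt_of_eq (p.2 l) hFd hcurve hval.symm).deriv
  simp only [Function.comp_def] at hd
  rw [hd]
  have hv : (fun j => (p.2 l)⁻¹ * ((μ j l : ℝ) * φ p j))
      = (p.2 l)⁻¹ • (fun j => (μ j l : ℝ) * φ p j) := rfl
  rw [hv, map_smul, smul_eq_mul, mul_inv_cancel_left₀ hyl.ne', ← Real.norm_eq_abs]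
  refine (ContinuousLinearMap.le_opNorm _ _).trans ?_
  refine mul_le_mul ((hB _ hmem).trans (le_abs_self B)) ?_ (norm_nonneg _) (abs_nonneg _)
  rw [pi_norm_le_iff_of_nonneg (Finset.sum_nonneg fun j _ => by positivity)]
  intro j
  rw [Real.norm_eq_abs, abs_mul]
  refine (mul_le_mul_of_nonneg_left (hφb p hp j) (abs_nonneg _)).trans ?_
  exact Finset.single_le_sum (f := fun j => |(μ j l : ℝ)| * |C|)
    (fun j _ => by positivity) (Finset.mem_univ j)
end
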